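/- Let φ, ψ : ℝ² → ℝ be C² functions and consider the graph X(x,y) = (x, y, φ(x,y), ψ(x,y)) in ℝ⁴. Suppose there exist ω ∈ (0, π/2] and d_0 > 0 such that: (i) at every point (x,y) ∈ ℝ², every unit vector N ∈ ℝ⁴ orthogonal to X_x(x,y) and X_y(x,y) satisfies |N·e_1| ≤ cos ω; and (ii) for every point p in the graph and every r > 0 there exists a C² conformally parametrized immersion X_r : B → ℝ⁴ with area element W_r > 0, whose image is contained in the graph of (φ,ψ), which is harmonic (ΔX_r = 0), satisfies X_r(0,0) = p, satisfies ∫₀¹ |(d/dt)(X_r∘γ)(t)| dt ≥ r for every continuous piecewise C¹ curve γ : [0,1] → closure(B) with γ(0) = (0,0) and |γ(1)| = 1, satisfies ∬_B |∇X_r|² du dv ≤ d_0 r², and whose plane mapping w ↦ (x¹_r(w), x²_r(w)) is injective with positive Jacobian determinant. Then φ and ψ are affine functions, i.e. the graph is an affine plane. -/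

import Mathlib

open scoped RealInnerProductSpace
open Metric Real

noncomputable section

abbrev E2 : Type := EuclideanSpace ℝ (Fin 2)
abbrev E4 : Type := EuclideanSpace ℝ (Fin 4)

/-- Partial derivative of a map `X : ℝ² → ℝ⁴` in the `i`-th coordinate direction. -/
def pd (X : E2 → E4) (i : Fin 2) (w : E2) : E4 :=
  fderiv ℝ X w (EuclideanSpace.single i 1)

/-- Second partial derivative `X_{uⁱ uʲ}`. -/
def pd2 (X : E2 → E4) (i j : Fin 2) (w : E2) : E4 :=
  pd (pd X i) j w

/-- Partial derivative of a scalar function on `ℝ²`. -/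
def pdR (f : E2 → ℝ) (i : Fin 2) (w : E2) : ℝ :=
  fderiv ℝ f w (EuclideanSpace.single i 1)

/-- The graph map `(x,y) ↦ (x, y, φ(x,y), ψ(x,y))` in `ℝ⁴`. -/
def graphMap (φ ψ : E2 → ℝ) (p : E2) : E4 :=
  (WithLp.equiv 2 (Fin 4 → ℝ)).symm ![p 0, p 1, φ p, ψ p]

/-- The coefficient `E = |X_x|²` of the first fundamental form of the graph of `(φ, ψ)`. -/
def metricE (φ ψ : E2 → ℝ) (p : E2) : ℝ := 1 + pdR φ 0 p ^ 2 + pdR ψ 0 p ^ 2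

/-- The coefficient `F = X_x · X_y` of the first fundamental form of the graph of `(φ, ψ)`. -/
def metricF (φ ψ : E2 → ℝ) (p : E2) : ℝ := pdR φ 0 p * pdR φ 1 p + pdR ψ 0 p * pdR ψ 1 p

/-- The coefficient `G = |X_y|²` of the first fundamental form of the graph of `(φ, ψ)`. -/
def metricG (φ ψ : E2 → ℝ) (p : E2) : ℝ := 1 + pdR φ 1 p ^ 2 + pdR ψ 1 p ^ 2

/-- The area element `√(EG - F²)` of the graph of `(φ, ψ)`. -/
def areaElement (φ ψ : E2 → ℝ) (p : E2) : ℝ :=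
  √(metricE φ ψ p * metricG φ ψ p - metricF φ ψ p ^ 2)

/-- The differential of the global isothermal parameter `ξ + iη` of a minimal graph. -/
def isothermalForm (φ ψ : E2 → ℝ) (p : E2) : E2 →L[ℝ] ℂ :=
  (EuclideanSpace.proj 0 : E2 →L[ℝ] ℝ).smulRight
      (⟨1 + metricE φ ψ p / areaElement φ ψ p, metricF φ ψ p / areaElement φ ψ p⟩ : ℂ) +
    (EuclideanSpace.proj 1 : E2 →L[ℝ] ℝ).smulRight
      (⟨metricF φ ψ p / areaElement φ ψ p, 1 + metricG φ ψ p / areaElement φ ψ p⟩ : ℂ)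

/-- The ratio `y_ζ / x_ζ` in a positively oriented isothermal parameter `ζ` of the graph. -/
def graphSlope (φ ψ : E2 → ℝ) (p : E2) : ℂ :=
  ⟨-metricF φ ψ p / metricG φ ψ p, -areaElement φ ψ p / metricG φ ψ p⟩

/-- The ratio `f_ζ / x_ζ` in a positively oriented isothermal parameter `ζ` of the graph,
for a function `f` of `(x, y)`. -/
def graphSlopeOf (φ ψ f : E2 → ℝ) (p : E2) : ℂ := pdR f 0 p + pdR f 1 p * graphSlope φ ψ p

/-- The identification of `E2` with the complex plane. -/
def toComplex : E2 →L[ℝ] ℂ :=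
  (EuclideanSpace.proj 0 : E2 →L[ℝ] ℝ).smulRight (1 : ℂ) +
    (EuclideanSpace.proj 1 : E2 →L[ℝ] ℝ).smulRight Complex.I

/-- Twice the Wirtinger derivative `∂f/∂w = (f_u - i f_v) / 2` of a real function. -/
def wirtinger (f : E2 → ℝ) (w : E2) : ℂ := ⟨pdR f 0 w, -pdR f 1 w⟩

theorem toComplex_apply (v : E2) : toComplex v = ⟨v 0, v 1⟩ := by
  apply Complex.ext <;> simp [toComplex]

theorem E2_decomp (v : E2) :
    v = v 0 • EuclideanSpace.single (0 : Fin 2) (1 : ℝ) +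
      v 1 • EuclideanSpace.single (1 : Fin 2) (1 : ℝ) := by
  ext i; fin_cases i <;> simp

theorem clm_apply_eq {F : Type*} [NormedAddCommGroup F] [NormedSpace ℝ F] (L : E2 →L[ℝ] F)
    (v : E2) :
    L v = v 0 • L (EuclideanSpace.single 0 1) + v 1 • L (EuclideanSpace.single 1 1) := by
  conv_lhs => rw [E2_decomp v]
  simp

theorem norm_sq_E2 (v : E2) : ‖v‖ ^ 2 = v 0 ^ 2 + v 1 ^ 2 := by
  simp [EuclideanSpace.norm_sq_eq]

theorem norm_toComplex (v : E2) : ‖toComplex v‖ = ‖v‖ := by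
  rw [← sq_eq_sq₀ (norm_nonneg _) (norm_nonneg _), norm_sq_E2, toComplex_apply, Complex.sq_norm,
    Complex.normSq_mk]
  ring

section Metric

variable (φ ψ : E2 → ℝ) (p : E2)

theorem metricE_pos : 0 < metricE φ ψ p := by unfold metricE; positivity

theorem metricG_pos : 0 < metricG φ ψ p := by unfold metricG; positivity

theorem metric_det_eq :
    metricE φ ψ p * metricG φ ψ p - metricF φ ψ p ^ 2 =
      1 + pdR φ 0 p ^ 2 + pdR ψ 0 p ^ 2 + pdR φ 1 p ^ 2 + pdR ψ 1 p ^ 2 +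
        (pdR φ 0 p * pdR ψ 1 p - pdR φ 1 p * pdR ψ 0 p) ^ 2 := by
  unfold metricE metricF metricG; ring

theorem metric_det_pos : 0 < metricE φ ψ p * metricG φ ψ p - metricF φ ψ p ^ 2 := by
  rw [metric_det_eq]; positivity

theorem areaElement_pos : 0 < areaElement φ ψ p := Real.sqrt_pos.2 (metric_det_pos φ ψ p)

theorem areaElement_sq :
    areaElement φ ψ p ^ 2 = metricE φ ψ p * metricG φ ψ p - metricF φ ψ p ^ 2 :=
  Real.sq_sqrt (metric_det_pos φ ψ p).le

theorem metricE_le_areaElement_sq : metricE φ ψ p ≤ areaElement φ ψ p ^ 2 := by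
  rw [areaElement_sq, metric_det_eq, metricE]; nlinarith [sq_nonneg (pdR φ 1 p),
    sq_nonneg (pdR ψ 1 p), sq_nonneg (pdR φ 0 p * pdR ψ 1 p - pdR φ 1 p * pdR ψ 0 p)]

end Metric

theorem contDiff_pdR {f : E2 → ℝ} (hf : ContDiff ℝ 2 f) (i : Fin 2) : ContDiff ℝ 1 (pdR f i) :=
  (hf.fderiv_right (m := 1) (by norm_num)).clm_apply contDiff_const

theorem contDiff_metricE {φ ψ : E2 → ℝ} (hφ : ContDiff ℝ 2 φ) (hψ : ContDiff ℝ 2 ψ) :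
    ContDiff ℝ 1 (metricE φ ψ) :=
  (contDiff_const.add ((contDiff_pdR hφ 0).pow 2)).add ((contDiff_pdR hψ 0).pow 2)

theorem contDiff_metricF {φ ψ : E2 → ℝ} (hφ : ContDiff ℝ 2 φ) (hψ : ContDiff ℝ 2 ψ) :
    ContDiff ℝ 1 (metricF φ ψ) :=
  ((contDiff_pdR hφ 0).mul (contDiff_pdR hφ 1)).add ((contDiff_pdR hψ 0).mul (contDiff_pdR hψ 1))

theorem contDiff_metricG {φ ψ : E2 → ℝ} (hφ : ContDiff ℝ 2 φ) (hψ : ContDiff ℝ 2 ψ) :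
    ContDiff ℝ 1 (metricG φ ψ) :=
  (contDiff_const.add ((contDiff_pdR hφ 1).pow 2)).add ((contDiff_pdR hψ 1).pow 2)

theorem contDiff_areaElement {φ ψ : E2 → ℝ} (hφ : ContDiff ℝ 2 φ) (hψ : ContDiff ℝ 2 ψ) :
    ContDiff ℝ 1 (areaElement φ ψ) :=
  (((contDiff_metricE hφ hψ).mul (contDiff_metricG hφ hψ)).sub
    ((contDiff_metricF hφ hψ).pow 2)).sqrt fun p => (metric_det_pos φ ψ p).ne'

theorem contDiff_complex_mk {f g : E2 → ℝ} (hf : ContDiff ℝ 1 f) (hg : ContDiff ℝ 1 g) :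
    ContDiff ℝ 1 fun p => (⟨f p, g p⟩ : ℂ) := by
  have h := (Complex.ofRealCLM.contDiff.comp hf).add
    ((Complex.ofRealCLM.contDiff.comp hg).mul (contDiff_const (c := Complex.I)))
  convert h using 2 with p
  exact Complex.mk_eq_add_mul_I _ _

theorem contDiff_isothermalForm {φ ψ : E2 → ℝ} (hφ : ContDiff ℝ 2 φ) (hψ : ContDiff ℝ 2 ψ) :
    ContDiff ℝ 1 (isothermalForm φ ψ) := by
  have hS := contDiff_areaElement hφ hψ
  have hS0 := fun p => (areaElement_pos φ ψ p).ne'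
  have hE := (contDiff_metricE hφ hψ).div hS hS0
  have hF := (contDiff_metricF hφ hψ).div hS hS0
  have hG := (contDiff_metricG hφ hψ).div hS hS0
  exact (contDiff_const.smulRight (contDiff_complex_mk (contDiff_const.add hE) hF)).add
    (contDiff_const.smulRight (contDiff_complex_mk hF (contDiff_const.add hG)))

theorem contDiff_graphSlope {φ ψ : E2 → ℝ} (hφ : ContDiff ℝ 2 φ) (hψ : ContDiff ℝ 2 ψ) :
    ContDiff ℝ 1 (graphSlope φ ψ) := by
  have hG := contDiff_metricG hφ hψ
  have hG0 := fun p => (metricG_pos φ ψ p).ne'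
  exact contDiff_complex_mk ((contDiff_metricF hφ hψ).neg.div hG hG0)
    ((contDiff_areaElement hφ hψ).neg.div hG hG0)

theorem contDiff_graphSlopeOf {φ ψ f : E2 → ℝ} (hφ : ContDiff ℝ 2 φ) (hψ : ContDiff ℝ 2 ψ)
    (hf : ContDiff ℝ 2 f) : ContDiff ℝ 1 (graphSlopeOf φ ψ f) :=
  (Complex.ofRealCLM.contDiff.comp (contDiff_pdR hf 0)).add
    ((Complex.ofRealCLM.contDiff.comp (contDiff_pdR hf 1)).mul (contDiff_graphSlope hφ hψ))

theorem isothermalForm_apply (φ ψ : E2 → ℝ) (p v : E2) :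
    isothermalForm φ ψ p v =
      ⟨v 0 + (metricE φ ψ p * v 0 + metricF φ ψ p * v 1) / areaElement φ ψ p,
        v 1 + (metricF φ ψ p * v 0 + metricG φ ψ p * v 1) / areaElement φ ψ p⟩ := by
  apply Complex.ext <;> simp [isothermalForm] <;> ring

/-- The isothermal form is strongly monotone. -/
theorem norm_sq_le_inner_isothermalForm (φ ψ : E2 → ℝ) (p v : E2) :
    ‖v‖ ^ 2 ≤ ⟪toComplex v, isothermalForm φ ψ p v⟫ := by
  have hS := areaElement_pos φ ψ p
  have hG := metricG_pos φ ψ p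
  have hq : 0 ≤ metricE φ ψ p * v 0 ^ 2 + 2 * metricF φ ψ p * v 0 * v 1 +
      metricG φ ψ p * v 1 ^ 2 := by
    unfold metricE metricF metricG
    nlinarith [sq_nonneg (pdR φ 0 p * v 0 + pdR φ 1 p * v 1),
      sq_nonneg (pdR ψ 0 p * v 0 + pdR ψ 1 p * v 1), sq_nonneg (v 0), sq_nonneg (v 1)]
  have h : ⟪toComplex v, isothermalForm φ ψ p v⟫ = v 0 ^ 2 + v 1 ^ 2 +
      (metricE φ ψ p * v 0 ^ 2 + 2 * metricF φ ψ p * v 0 * v 1 +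
        metricG φ ψ p * v 1 ^ 2) / areaElement φ ψ p := by
    rw [toComplex_apply, isothermalForm_apply, Complex.inner]
    simp
    ring
  rw [h, norm_sq_E2]
  have := div_nonneg hq hS.le
  linarith

theorem norm_le_norm_isothermalForm (φ ψ : E2 → ℝ) (p v : E2) :
    ‖v‖ ≤ ‖isothermalForm φ ψ p v‖ := by
  have h1 := norm_sq_le_inner_isothermalForm φ ψ p v
  have h2 := real_inner_le_norm (toComplex v) (isothermalForm φ ψ p v)
  rw [norm_toComplex] at h2
  rcases (norm_nonneg v).eq_or_lt with h | h
  · rw [← h]; exact norm_nonneg _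
  · nlinarith

/-- The isothermal form at a point, as a linear isomorphism. -/
def isothermalEquiv (φ ψ : E2 → ℝ) (p : E2) : E2 ≃L[ℝ] ℂ :=
  (LinearEquiv.ofInjectiveOfFinrankEq (isothermalForm φ ψ p : E2 →ₗ[ℝ] ℂ)
    ((injective_iff_map_eq_zero _).2 fun v hv => norm_le_zero_iff.1 <| by
      simpa [show isothermalForm φ ψ p v = 0 from hv] using norm_le_norm_isothermalForm φ ψ p v)
    (by simp [Complex.finrank_real_complex])).toContinuousLinearEquiv

theorem coe_isothermalEquiv (φ ψ : E2 → ℝ) (p : E2) :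
    (isothermalEquiv φ ψ p : E2 →L[ℝ] ℂ) = isothermalForm φ ψ p := rfl

/-- A primitive of the isothermal form is expanding. -/
theorem norm_sub_le_of_hasFDerivAt_isothermalForm {φ ψ : E2 → ℝ} {Z : E2 → ℂ}
    (hZ : ∀ p, HasFDerivAt Z (isothermalForm φ ψ p) p) (p q : E2) : ‖p - q‖ ≤ ‖Z p - Z q‖ := by
  set v := p - q with hv
  have hd : ∀ t : ℝ, HasDerivAt (fun t : ℝ => ⟪toComplex v, Z (q + t • v)⟫)
      ⟪toComplex v, isothermalForm φ ψ (q + t • v) v⟫ t := fun t => by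
    have h1 : HasDerivAt (fun t : ℝ => q + t • v) v t := by
      simpa using ((hasDerivAt_id t).smul_const v).const_add q
    have h2 := (hZ (q + t • v)).comp_hasDerivAt t h1
    simpa using (hasDerivAt_const t (toComplex v)).inner ℝ h2
  have hm := mul_sub_le_image_sub_of_le_deriv (fun t => (hd t).differentiableAt)
    (C := ‖v‖ ^ 2) (fun t => by
      rw [(hd t).deriv]; exact norm_sq_le_inner_isothermalForm φ ψ _ v) (zero_le_one' ℝ)
  have hpq : q + v = p := by simp [hv]
  simp only [sub_zero, mul_one, one_smul, zero_smul, add_zero, hpq, ← inner_sub_right] at hm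
  have h2 := real_inner_le_norm (toComplex v) (Z p - Z q)
  rw [norm_toComplex] at h2
  rcases (norm_nonneg v).eq_or_lt with h | h
  · rw [← h]; exact norm_nonneg _
  · nlinarith

/-- A primitive of the isothermal form is a global coordinate. -/
theorem exists_homeomorph_of_hasFDerivAt_isothermalForm {φ ψ : E2 → ℝ} (hφ : ContDiff ℝ 2 φ)
    (hψ : ContDiff ℝ 2 ψ) {Z : E2 → ℂ} (hZ : ∀ p, HasFDerivAt Z (isothermalForm φ ψ p) p) :
    ∃ e : E2 ≃ₜ ℂ, ∀ p, e p = Z p := by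
  have hcont : Continuous Z := continuous_iff_continuousAt.2 fun p => (hZ p).continuousAt
  have hanti : AntilipschitzWith 1 Z := AntilipschitzWith.of_le_mul_dist fun p q => by
    simpa [dist_eq_norm] using norm_sub_le_of_hasFDerivAt_isothermalForm hZ p q
  have hopen : IsOpenMap Z := isOpenMap_of_hasStrictFDerivAt_equiv (f' := isothermalEquiv φ ψ)
    fun p => hasStrictFDerivAt_of_hasFDerivAt_of_continuousAt (Filter.Eventually.of_forall hZ)
      (contDiff_isothermalForm hφ hψ).continuous.continuousAt
  have hclosed : IsClosed (Set.range Z) := by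
    have : IsProperMap Z := isProperMap_iff_tendsto_cocompact.2 ⟨hcont, by
      rw [← Metric.cobounded_eq_cocompact, ← Metric.cobounded_eq_cocompact]
      exact hanti.tendsto_cobounded⟩
    exact this.isClosedMap.isClosed_range
  have hsurj : Function.Surjective Z := Set.range_eq_univ.1 <|
    IsClopen.eq_univ ⟨hclosed, hopen.isOpen_range⟩ (Set.range_nonempty Z)
  exact ⟨(Equiv.ofBijective Z ⟨hanti.injective, hsurj⟩).toHomeomorphOfContinuousOpen hcont hopen,
    fun p => rfl⟩

/-- A bounded function whose differential is everywhere a complex multiple of the isothermal form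
is constant. -/
theorem eq_of_fderiv_eq_smul_isothermalForm {φ ψ : E2 → ℝ} (hφ : ContDiff ℝ 2 φ)
    (hψ : ContDiff ℝ 2 ψ) {Z : E2 → ℂ} (hZ : ∀ p, HasFDerivAt Z (isothermalForm φ ψ p) p)
    {κ : E2 → ℂ} (hκ : ∀ p, ∃ k : ℂ, HasFDerivAt κ (k • isothermalForm φ ψ p) p) {C : ℝ}
    (hC : ∀ p, ‖κ p‖ ≤ C) (p q : E2) : κ p = κ q := by
  obtain ⟨e, he⟩ := exists_homeomorph_of_hasFDerivAt_isothermalForm hφ hψ hZ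
  have hd : Differentiable ℂ (κ ∘ e.symm) := fun ζ => by
    obtain ⟨k, hk⟩ := hκ (e.symm ζ)
    have h1 : HasFDerivAt e.symm
        ((isothermalEquiv φ ψ (e.symm ζ)).symm : ℂ →L[ℝ] E2) ζ :=
      HasFDerivAt.of_local_left_inverse e.symm.continuous.continuousAt (hZ (e.symm ζ))
        (Filter.Eventually.of_forall fun y => by rw [← he, e.apply_symm_apply])
    have h2 : (k • isothermalForm φ ψ (e.symm ζ)).comp
        ((isothermalEquiv φ ψ (e.symm ζ)).symm : ℂ →L[ℝ] E2) =
          (k • ContinuousLinearMap.id ℂ ℂ).restrictScalars ℝ := by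
      ext1 z
      simp [← coe_isothermalEquiv]
    exact (hasFDerivAt_of_restrictScalars ℝ (hk.comp ζ h1) h2.symm).differentiableAt
  have hb : Bornology.IsBounded (Set.range (κ ∘ e.symm)) :=
    isBounded_iff_forall_norm_le.2 ⟨C, by rintro _ ⟨ζ, rfl⟩; exact hC _⟩
  simpa using hd.apply_eq_apply_of_bounded hb (e p) (e q)

theorem pd_apply {X : E2 → E4} {w : E2} (hX : DifferentiableAt ℝ X w) (i : Fin 2) (k : Fin 4) :
    pd X i w k = pdR (fun w' => X w' k) i w := by
  have h := ((EuclideanSpace.proj k : E4 →L[ℝ] ℝ).hasFDerivAt (x := X w)).comp w hX.hasFDerivAt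
  have h2 : fderiv ℝ (fun w' => X w' k) w =
      (EuclideanSpace.proj k : E4 →L[ℝ] ℝ).comp (fderiv ℝ X w) := h.fderiv
  rw [pdR, h2]
  rfl

theorem inner_E4 (u v : E4) : ⟪u, v⟫ = u 0 * v 0 + u 1 * v 1 + u 2 * v 2 + u 3 * v 3 := by
  simp [PiLp.inner_apply, Fin.sum_univ_four]
  ring

theorem pdR_coord (i j : Fin 2) (p : E2) :
    pdR (fun q : E2 => q i) j p = if i = j then 1 else 0 := by
  have h : fderiv ℝ (fun q : E2 => q i) p = (EuclideanSpace.proj i : E2 →L[ℝ] ℝ) :=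
    (EuclideanSpace.proj i : E2 →L[ℝ] ℝ).hasFDerivAt.fderiv
  rw [pdR, h]
  simp

theorem contDiff_graphMap {φ ψ : E2 → ℝ} (hφ : ContDiff ℝ 2 φ) (hψ : ContDiff ℝ 2 ψ) :
    ContDiff ℝ 2 (graphMap φ ψ) := by
  refine contDiff_euclidean.2 fun i => ?_
  fin_cases i
  · exact (EuclideanSpace.proj 0 : E2 →L[ℝ] ℝ).contDiff
  · exact (EuclideanSpace.proj 1 : E2 →L[ℝ] ℝ).contDiff
  · exact hφ
  · exact hψ

/-- If all normals of the graph make an angle of at least `ω` with the `x¹`-axis, then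
`g¹¹ = G / (EG - F²)` is at least `sin² ω`. -/
theorem sin_sq_mul_areaElement_sq_le {φ ψ : E2 → ℝ} (hφ : ContDiff ℝ 2 φ) (hψ : ContDiff ℝ 2 ψ)
    {ω : ℝ} (p : E2)
    (hangle : ∀ N : E4, ‖N‖ = 1 →
      ⟪N, pd (graphMap φ ψ) 0 p⟫ = 0 → ⟪N, pd (graphMap φ ψ) 1 p⟫ = 0 →
      |⟪N, EuclideanSpace.single (0 : Fin 4) 1⟫| ≤ Real.cos ω) :
    Real.sin ω ^ 2 * areaElement φ ψ p ^ 2 ≤ metricG φ ψ p := by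
  have hd : DifferentiableAt ℝ (graphMap φ ψ) p :=
    (contDiff_graphMap hφ hψ).contDiffAt.differentiableAt two_ne_zero
  have c0 : ∀ i, pd (graphMap φ ψ) i p 0 = if 0 = i then 1 else 0 := fun i => by
    rw [pd_apply hd]; exact pdR_coord 0 i p
  have c1 : ∀ i, pd (graphMap φ ψ) i p 1 = if 1 = i then 1 else 0 := fun i => by
    rw [pd_apply hd]; exact pdR_coord 1 i p
  have c2 : ∀ i, pd (graphMap φ ψ) i p 2 = pdR φ i p := fun i => pd_apply hd i 2
  have c3 : ∀ i, pd (graphMap φ ψ) i p 3 = pdR ψ i p := fun i => pd_apply hd i 3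
  have hS := areaElement_pos φ ψ p
  have hS2 := areaElement_sq φ ψ p
  set S := areaElement φ ψ p
  set α := metricG φ ψ p / S ^ 2 with hα
  set β := -metricF φ ψ p / S ^ 2 with hβ
  have hEq1 : metricE φ ψ p * α + metricF φ ψ p * β = 1 := by
    rw [hα, hβ]; field_simp; rw [hS2]; ring
  have hEq2 : metricF φ ψ p * α + metricG φ ψ p * β = 0 := by
    rw [hα, hβ]; field_simp; ring
  set v : E4 := !₂[1 - α, -β, -(α * pdR φ 0 p + β * pdR φ 1 p),
    -(α * pdR ψ 0 p + β * pdR ψ 1 p)] with hv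
  have v0 : v 0 = 1 - α := rfl
  have v1 : v 1 = -β := rfl
  have v2 : v 2 = -(α * pdR φ 0 p + β * pdR φ 1 p) := rfl
  have v3 : v 3 = -(α * pdR ψ 0 p + β * pdR ψ 1 p) := rfl
  have hv0 : ⟪v, pd (graphMap φ ψ) 0 p⟫ = 0 := by
    rw [inner_E4, c0, c1, c2, c3, v0, v1, v2, v3]
    unfold metricE metricF at hEq1
    simp only [if_true, one_ne_zero, if_false]
    linear_combination -hEq1
  have hv1 : ⟪v, pd (graphMap φ ψ) 1 p⟫ = 0 := by
    rw [inner_E4, c0, c1, c2, c3, v0, v1, v2, v3]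
    unfold metricF metricG at hEq2
    simp only [if_true, zero_ne_one, if_false]
    linear_combination -hEq2
  have hve : ⟪v, EuclideanSpace.single (0 : Fin 4) (1 : ℝ)⟫ = 1 - α := by
    rw [inner_E4, v0]; simp
  have hvv : ‖v‖ ^ 2 = 1 - α := by
    rw [← real_inner_self_eq_norm_sq, inner_E4, v0, v1, v2, v3]
    unfold metricE metricF at hEq1
    unfold metricF metricG at hEq2
    linear_combination α * hEq1 + β * hEq2
  have key : Real.sin ω ^ 2 ≤ α := by
    rcases (norm_nonneg v).eq_or_lt with h | h
    · rw [← h] at hvv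
      nlinarith [Real.sin_sq_add_cos_sq ω, sq_nonneg (Real.cos ω)]
    · have := hangle (‖v‖⁻¹ • v) (by rw [norm_smul, norm_inv, norm_norm, inv_mul_cancel₀ h.ne'])
        (by rw [real_inner_smul_left, hv0, mul_zero]) (by rw [real_inner_smul_left, hv1, mul_zero])
      rw [real_inner_smul_left, hve, ← hvv, pow_two, inv_mul_cancel_left₀ h.ne',
        abs_of_pos h] at this
      nlinarith [Real.sin_sq_add_cos_sq ω]
  rwa [hα, le_div_iff₀ (by positivity)] at key

theorem normSq_graphSlope_add (φ ψ : E2 → ℝ) (p : E2) :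
    1 + Complex.normSq (graphSlope φ ψ p) + Complex.normSq (graphSlopeOf φ ψ φ p) +
      Complex.normSq (graphSlopeOf φ ψ ψ p) = 2 * areaElement φ ψ p ^ 2 / metricG φ ψ p := by
  have hG := metricG_pos φ ψ p
  have hS2 := areaElement_sq φ ψ p
  have hE' : metricE φ ψ p = 1 + pdR φ 0 p ^ 2 + pdR ψ 0 p ^ 2 := rfl
  have hF' : metricF φ ψ p = pdR φ 0 p * pdR φ 1 p + pdR ψ 0 p * pdR ψ 1 p := rfl
  have hG' : metricG φ ψ p = 1 + pdR φ 1 p ^ 2 + pdR ψ 1 p ^ 2 := rfl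
  simp only [graphSlopeOf, graphSlope, Complex.normSq_apply, Complex.add_re, Complex.add_im,
    Complex.mul_re, Complex.mul_im, Complex.ofReal_re, Complex.ofReal_im]
  field_simp
  generalize areaElement φ ψ p = S at *
  generalize metricE φ ψ p = E at *
  generalize metricF φ ψ p = F at *
  generalize metricG φ ψ p = G at *
  linear_combination (1 + pdR φ 1 p ^ 2 + pdR ψ 1 p ^ 2 - 2 * G) * hS2 - G ^ 2 * hE' -
    E * G * hG' + 2 * F * G * hF'

/-- Conformality of a positively oriented parametrization, expressed in the metric `E, F, G`. -/
theorem conformal_relations {E F G S xu xv yu yv W : ℝ} (hS : 0 < S) (hS2 : S ^ 2 = E * G - F ^ 2)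
    (huu : E * xu ^ 2 + 2 * F * xu * yu + G * yu ^ 2 = W)
    (hvv : E * xv ^ 2 + 2 * F * xv * yv + G * yv ^ 2 = W)
    (huv : E * xu * xv + F * (xu * yv + xv * yu) + G * yu * yv = 0)
    (hJ : 0 < xu * yv - xv * yu) (hW : 0 < W) :
    E * xu + F * yu = S * yv ∧ F * xu + G * yu = -(S * xv) ∧
      E * xv + F * yv = -(S * yu) ∧ F * xv + G * yv = S * xu := by
  set J := xu * yv - xv * yu with hJdef
  have hWS : W = S * J := by
    rw [← sq_eq_sq₀ hW.le (by positivity), mul_pow, hS2, hJdef]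
    nth_rewrite 1 [pow_two]
    nth_rewrite 1 [← huu]
    rw [← hvv]
    linear_combination (E * xu * xv + F * (xu * yv + xv * yu) + G * yu * yv) * huv
  refine ⟨?_, ?_, ?_, ?_⟩ <;> apply mul_left_cancel₀ hJ.ne'
  · linear_combination yv * huu + yv * hWS - yu * huv + (E * xu + F * yu) * hJdef
  · linear_combination -xv * huu - xv * hWS + xu * huv + (F * xu + G * yu) * hJdef
  · linear_combination -yu * hvv - yu * hWS + yv * huv + (E * xv + F * yv) * hJdef
  · linear_combination xu * hvv + xu * hWS - xv * huv + (F * xv + G * yv) * hJdef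

theorem differentiableAt_fderiv {F : Type*} [NormedAddCommGroup F] [NormedSpace ℝ F] {f : E2 → F}
    {w : E2} (hf : ContDiffAt ℝ 2 f w) : DifferentiableAt ℝ (fderiv ℝ f) w :=
  (hf.fderiv_right (m := 1) (by norm_num)).differentiableAt one_ne_zero

theorem fderiv_pdR {f : E2 → ℝ} {w : E2} (hf : ContDiffAt ℝ 2 f w) (i : Fin 2) :
    HasFDerivAt (pdR f i) ((fderiv ℝ (fderiv ℝ f) w).flip (EuclideanSpace.single i 1)) w := by
  have h := (differentiableAt_fderiv hf).hasFDerivAt.clm_apply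
    (hasFDerivAt_const (EuclideanSpace.single i (1 : ℝ)) w)
  simpa [pdR] using! h

/-- The Wirtinger derivative of a harmonic function is holomorphic. -/
theorem hasFDerivAt_wirtinger {f : E2 → ℝ} {w : E2} (hf : ContDiffAt ℝ 2 f w)
    (hharm : pdR (pdR f 0) 0 w + pdR (pdR f 1) 1 w = 0) :
    ∃ k : ℂ, HasFDerivAt (wirtinger f) (k • toComplex) w := by
  have hsymm := hf.isSymmSndFDerivAt (by simp)
  have h0 := fderiv_pdR hf 0
  have h1 := fderiv_pdR hf 1
  set D := fderiv ℝ (fderiv ℝ f) w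
  have hs : D (EuclideanSpace.single 0 1) (EuclideanSpace.single 1 1) =
    D (EuclideanSpace.single 1 1) (EuclideanSpace.single 0 1) := hsymm _ _
  have hh : D (EuclideanSpace.single 0 1) (EuclideanSpace.single 0 1) +
      D (EuclideanSpace.single 1 1) (EuclideanSpace.single 1 1) = 0 := by
    rw [pdR, pdR, h0.fderiv, h1.fderiv] at hharm
    exact hharm
  refine ⟨⟨D (EuclideanSpace.single 0 1) (EuclideanSpace.single 0 1),
    -D (EuclideanSpace.single 0 1) (EuclideanSpace.single 1 1)⟩, ?_⟩
  have h := (Complex.ofRealCLM.hasFDerivAt.comp w h0).add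
    ((Complex.ofRealCLM.hasFDerivAt.comp w h1.neg).mul_const Complex.I)
  have hw : wirtinger f = fun w => (pdR f 0 w : ℂ) + ((-pdR f 1 w : ℝ) : ℂ) * Complex.I := by
    funext w; exact Complex.mk_eq_add_mul_I _ _
  rw [hw]
  refine h.congr_fderiv ?_
  ext1 v
  have e0 := clm_apply_eq (D.flip (EuclideanSpace.single 0 1)) v
  have e1 := clm_apply_eq (D.flip (EuclideanSpace.single 1 1)) v
  simp only [ContinuousLinearMap.flip_apply, smul_eq_mul] at e0 e1
  apply Complex.ext
  · simp [toComplex_apply, e0]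
    linear_combination -v 1 * hs
  · simp [toComplex_apply, e1]
    linear_combination -v 1 * hh

theorem eq_graphMap_of_mem {φ ψ : E2 → ℝ} {x : E4} (h : ∃ q : E2, x = graphMap φ ψ q) :
    x = graphMap φ ψ !₂[x 0, x 1] := by
  obtain ⟨q, rfl⟩ := h
  congr 1
  ext i; fin_cases i <;> rfl

/-- In the neighbourhood of a point around which the graph has a positively oriented conformal
harmonic parametrization, the isothermal form is closed and the slopes are holomorphic. -/
theorem closed_and_holomorphic_of_disc {φ ψ : E2 → ℝ} (hφ : ContDiff ℝ 2 φ) (hψ : ContDiff ℝ 2 ψ)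
    {X : E2 → E4} {W : E2 → ℝ} {U : Set E2} (hU : IsOpen U) {w₀ p : E2} (hw₀ : w₀ ∈ U)
    (hX : ContDiffOn ℝ 2 X U)
    (hconf : ∀ w ∈ U, ⟪pd X 0 w, pd X 0 w⟫ = W w ∧ ⟪pd X 1 w, pd X 1 w⟫ = W w ∧
      ⟪pd X 0 w, pd X 1 w⟫ = 0 ∧ 0 < W w)
    (hgraph : ∀ w ∈ U, ∃ q : E2, X w = graphMap φ ψ q)
    (hharm : ∀ w ∈ U, pd2 X 0 0 w + pd2 X 1 1 w = 0)
    (hp : X w₀ = graphMap φ ψ p)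
    (hJ : ∀ w ∈ U, 0 < pdR (fun w' => X w' 0) 0 w * pdR (fun w' => X w' 1) 1 w
      - pdR (fun w' => X w' 0) 1 w * pdR (fun w' => X w' 1) 0 w) :
    (∀ u v, fderiv ℝ (isothermalForm φ ψ) p u v = fderiv ℝ (isothermalForm φ ψ) p v u) ∧
      ∀ κ ∈ ({graphSlope φ ψ, graphSlopeOf φ ψ φ, graphSlopeOf φ ψ ψ} : Set (E2 → ℂ)),
        ∃ k : ℂ, HasFDerivAt κ (k • isothermalForm φ ψ p) p := by
  have hXat : ∀ w ∈ U, ContDiffAt ℝ 2 X w := fun w hw => hX.contDiffAt (hU.mem_nhds hw)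
  set x : Fin 4 → E2 → ℝ := fun k w => X w k with hx
  have hxat : ∀ k, ∀ w ∈ U, ContDiffAt ℝ 2 (x k) w := fun k w hw =>
    (EuclideanSpace.proj k : E4 →L[ℝ] ℝ).contDiff.contDiffAt.comp w (hXat w hw)
  set P : E2 → E2 := fun w => !₂[X w 0, X w 1] with hP
  have hPat : ∀ w ∈ U, ContDiffAt ℝ 2 P w := fun w hw => by
    refine contDiffAt_euclidean.2 fun i => ?_
    fin_cases i
    · exact hxat 0 w hw
    · exact hxat 1 w hw
  have hPd : ∀ w ∈ U, HasFDerivAt P (fderiv ℝ P w) w := fun w hw =>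
    ((hPat w hw).differentiableAt two_ne_zero).hasFDerivAt
  have hXP : ∀ w ∈ U, X w = graphMap φ ψ (P w) := fun w hw =>
    eq_graphMap_of_mem (hgraph w hw)
  have hPp : P w₀ = p := by
    have h := hXP w₀ hw₀
    rw [hp] at h
    have h0 : p 0 = P w₀ 0 := congrArg (fun y : E4 => y 0) h
    have h1 : p 1 = P w₀ 1 := congrArg (fun y : E4 => y 1) h
    ext i; fin_cases i
    · exact h0.symm
    · exact h1.symm
  -- first derivatives in terms of coordinates
  have hP0 : ∀ w ∈ U, ∀ v, fderiv ℝ P w v 0 = fderiv ℝ (x 0) w v := fun w hw v => by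
    have h : HasFDerivAt (x 0) _ w :=
      ((EuclideanSpace.proj 0 : E2 →L[ℝ] ℝ).hasFDerivAt (x := P w)).comp w (hPd w hw)
    rw [h.fderiv]; rfl
  have hP1 : ∀ w ∈ U, ∀ v, fderiv ℝ P w v 1 = fderiv ℝ (x 1) w v := fun w hw v => by
    have h : HasFDerivAt (x 1) _ w :=
      ((EuclideanSpace.proj 1 : E2 →L[ℝ] ℝ).hasFDerivAt (x := P w)).comp w (hPd w hw)
    rw [h.fderiv]; rfl
  have hcomp : ∀ f : E2 → ℝ, ContDiff ℝ 2 f → ∀ k, (∀ w ∈ U, x k w = f (P w)) →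
      ∀ w ∈ U, ∀ i, pdR (x k) i w =
        pdR f 0 (P w) * pdR (x 0) i w + pdR f 1 (P w) * pdR (x 1) i w := by
    intro f hf k hk w hw i
    have hfd : HasFDerivAt f (fderiv ℝ f (P w)) (P w) :=
      (hf.contDiffAt.differentiableAt two_ne_zero).hasFDerivAt
    have h : HasFDerivAt (x k) _ w := (hfd.comp w (hPd w hw)).congr_of_eventuallyEq
      (Filter.eventuallyEq_of_mem (hU.mem_nhds hw) hk)
    rw [pdR, h.fderiv, ContinuousLinearMap.comp_apply, clm_apply_eq, hP0 w hw, hP1 w hw]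
    simp only [smul_eq_mul, pdR]
    ring
  have hx2 := hcomp φ hφ 2 fun w hw => congrArg (fun y : E4 => y 2) (hXP w hw)
  have hx3 := hcomp ψ hψ 3 fun w hw => congrArg (fun y : E4 => y 3) (hXP w hw)
  have hpd : ∀ w ∈ U, ∀ i k, pd X i w k = pdR (x k) i w := fun w hw i k =>
    pd_apply ((hXat w hw).differentiableAt two_ne_zero) i k
  have hrel := fun w (hw : w ∈ U) => by
    obtain ⟨huu, hvv, huv, hW⟩ := hconf w hw
    rw [inner_E4] at huu hvv huv
    simp only [hpd w hw, hx2 w hw, hx3 w hw] at huu hvv huv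
    refine conformal_relations (areaElement_pos φ ψ (P w)) (areaElement_sq φ ψ (P w))
      (xu := pdR (x 0) 0 w) (xv := pdR (x 0) 1 w) (yu := pdR (x 1) 0 w) (yv := pdR (x 1) 1 w)
      (W := W w) ?_ ?_ ?_ (hJ w hw) hW
    · rw [← huu]; unfold metricE metricF metricG; ring
    · rw [← hvv]; unfold metricE metricF metricG; ring
    · rw [← huv]; unfold metricE metricF metricG; ring
  -- the isothermal form and the slopes in the conformal parameter
  set m : E2 → ℂ := fun w => wirtinger (x 0) w + Complex.I * wirtinger (x 1) w with hm
  have hform : ∀ w ∈ U, ∀ v, isothermalForm φ ψ (P w) (fderiv ℝ P w v) = m w * toComplex v := by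
    intro w hw v
    obtain ⟨r1, r2, r3, r4⟩ := hrel w hw
    have hS := (areaElement_pos φ ψ (P w)).ne'
    have e0 := clm_apply_eq (fderiv ℝ (x 0) w) v
    have e1 := clm_apply_eq (fderiv ℝ (x 1) w) v
    rw [isothermalForm_apply, hP0 w hw, hP1 w hw, e0, e1, toComplex_apply]
    change (⟨v 0 * pdR (x 0) 0 w + v 1 * pdR (x 0) 1 w +
        (metricE φ ψ (P w) * (v 0 * pdR (x 0) 0 w + v 1 * pdR (x 0) 1 w) +
          metricF φ ψ (P w) * (v 0 * pdR (x 1) 0 w + v 1 * pdR (x 1) 1 w)) /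
          areaElement φ ψ (P w),
      v 0 * pdR (x 1) 0 w + v 1 * pdR (x 1) 1 w +
        (metricF φ ψ (P w) * (v 0 * pdR (x 0) 0 w + v 1 * pdR (x 0) 1 w) +
          metricG φ ψ (P w) * (v 0 * pdR (x 1) 0 w + v 1 * pdR (x 1) 1 w)) /
          areaElement φ ψ (P w)⟩ : ℂ) = _
    apply Complex.ext
    · simp [hm, wirtinger]
      field_simp
      linear_combination v 0 * r1 + v 1 * r3
    · simp [hm, wirtinger]
      field_simp
      linear_combination v 0 * r2 + v 1 * r4
  have hslope : ∀ w ∈ U, graphSlope φ ψ (P w) * wirtinger (x 0) w = wirtinger (x 1) w := by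
    intro w hw
    obtain ⟨r1, r2, r3, r4⟩ := hrel w hw
    have hG := (metricG_pos φ ψ (P w)).ne'
    apply Complex.ext
    · simp [graphSlope, wirtinger]
      field_simp
      linear_combination -r2
    · simp [graphSlope, wirtinger]
      field_simp
      linear_combination r4
  have hslopeOf : ∀ f k, (∀ w ∈ U, ∀ i, pdR (x k) i w =
      pdR f 0 (P w) * pdR (x 0) i w + pdR f 1 (P w) * pdR (x 1) i w) →
      ∀ w ∈ U, graphSlopeOf φ ψ f (P w) * wirtinger (x 0) w = wirtinger (x k) w := by
    intro f k hk w hw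
    rw [graphSlopeOf, add_mul, mul_assoc, hslope w hw]
    apply Complex.ext
    · simp [wirtinger, hk w hw]
    · simp [wirtinger, hk w hw]; ring
  -- holomorphy
  have hhol : ∀ k, ∃ c : ℂ, HasFDerivAt (wirtinger (x k)) (c • toComplex) w₀ := by
    intro k
    refine hasFDerivAt_wirtinger (hxat k w₀ hw₀) ?_
    have h2 : ∀ i, pd2 X i i w₀ k = pdR (pdR (x k) i) i w₀ := fun i => by
      have hd : DifferentiableAt ℝ (pd X i) w₀ :=
        ((differentiableAt_fderiv (hXat w₀ hw₀)).hasFDerivAt.clm_apply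
          (hasFDerivAt_const (EuclideanSpace.single i (1 : ℝ)) w₀)).differentiableAt
      rw [pd2, pd_apply hd, pdR, pdR, Filter.EventuallyEq.fderiv_eq]
      exact Filter.eventuallyEq_of_mem (hU.mem_nhds hw₀) fun w hw => hpd w hw i k
    have h := congrArg (fun y : E4 => y k) (hharm w₀ hw₀)
    simpa [h2] using h
  obtain ⟨c0, hc0⟩ := hhol 0
  have hne : wirtinger (x 0) w₀ ≠ 0 := fun h => by
    have h0 : pdR (x 0) 0 w₀ = 0 := congrArg Complex.re h
    have h1 : -pdR (x 0) 1 w₀ = 0 := congrArg Complex.im h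
    have := hJ w₀ hw₀
    change 0 < pdR (x 0) 0 w₀ * _ - pdR (x 0) 1 w₀ * _ at this
    rw [h0, neg_eq_zero.1 h1] at this
    simp at this
  have hA := ((contDiff_isothermalForm hφ hψ).contDiffAt (x := p)).differentiableAt one_ne_zero
  have hPw₀ := hPd w₀ hw₀
  have hsurj : ∀ v : E2, ∃ u, fderiv ℝ P w₀ u = v := fun v => by
    set J := pdR (x 0) 0 w₀ * pdR (x 1) 1 w₀ - pdR (x 0) 1 w₀ * pdR (x 1) 0 w₀ with hJdef
    have hJ0 : J ≠ 0 := (hJ w₀ hw₀).ne'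
    refine ⟨!₂[(v 0 * pdR (x 1) 1 w₀ - v 1 * pdR (x 0) 1 w₀) / J,
      (v 1 * pdR (x 0) 0 w₀ - v 0 * pdR (x 1) 0 w₀) / J], ?_⟩
    ext i
    fin_cases i
    · change fderiv ℝ P w₀ _ 0 = v 0
      rw [hP0 w₀ hw₀, clm_apply_eq]
      change (v 0 * pdR (x 1) 1 w₀ - v 1 * pdR (x 0) 1 w₀) / J * pdR (x 0) 0 w₀ +
        (v 1 * pdR (x 0) 0 w₀ - v 0 * pdR (x 1) 0 w₀) / J * pdR (x 0) 1 w₀ = v 0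
      field_simp
      rw [hJdef]; ring
    · change fderiv ℝ P w₀ _ 1 = v 1
      rw [hP1 w₀ hw₀, clm_apply_eq]
      change (v 0 * pdR (x 1) 1 w₀ - v 1 * pdR (x 0) 1 w₀) / J * pdR (x 1) 0 w₀ +
        (v 1 * pdR (x 0) 0 w₀ - v 0 * pdR (x 1) 0 w₀) / J * pdR (x 1) 1 w₀ = v 1
      field_simp
      rw [hJdef]; ring
  have hm0 : m w₀ ≠ 0 := fun h => by
    obtain ⟨u, hu⟩ := hsurj (EuclideanSpace.single 0 1)
    have h1 := hform w₀ hw₀ u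
    have h2 := norm_le_norm_isothermalForm φ ψ (P w₀) (EuclideanSpace.single 0 1)
    rw [hu, h, zero_mul] at h1
    rw [h1] at h2
    norm_num at h2
  refine ⟨?_, ?_⟩
  · obtain ⟨c1, hc1⟩ := hhol 1
    have hmd : HasFDerivAt m ((c0 + Complex.I * c1) • toComplex) w₀ := by
      refine (hc0.add (hc1.const_mul Complex.I)).congr_fderiv ?_
      ext1 v
      simp; ring
    have key : ∀ a b : E2,
        fderiv ℝ (isothermalForm φ ψ) p (fderiv ℝ P w₀ a) (fderiv ℝ P w₀ b) +
          isothermalForm φ ψ p (fderiv ℝ (fderiv ℝ P) w₀ a b) =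
        (c0 + Complex.I * c1) * toComplex a * toComplex b := fun a b => by
      have h1 : HasFDerivAt (fun w => isothermalForm φ ψ (P w))
          ((fderiv ℝ (isothermalForm φ ψ) p).comp (fderiv ℝ P w₀)) w₀ :=
        HasFDerivAt.comp (g := isothermalForm φ ψ) w₀ (by rw [hPp]; exact hA.hasFDerivAt) hPw₀
      have h2 := (differentiableAt_fderiv (hPat w₀ hw₀)).hasFDerivAt.clm_apply
        (hasFDerivAt_const b w₀)
      have h3 := h1.clm_apply h2
      have h4 := h3.unique ((hmd.mul_const (toComplex b)).congr_of_eventuallyEq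
        (Filter.eventuallyEq_of_mem (hU.mem_nhds hw₀) fun w hw => hform w hw b))
      have h5 := congrArg (fun L : E2 →L[ℝ] ℂ => L a) h4
      simp [hPp] at h5
      linear_combination h5
    intro u v
    obtain ⟨a, rfl⟩ := hsurj u
    obtain ⟨b, rfl⟩ := hsurj v
    have hs : fderiv ℝ (fderiv ℝ P) w₀ a b = fderiv ℝ (fderiv ℝ P) w₀ b a :=
      (hPat w₀ hw₀).isSymmSndFDerivAt (by simp) a b
    have k1 := key a b
    have k2 := key b a
    rw [hs] at k1
    linear_combination k1 - k2
  · have main : ∀ (κ : E2 → ℂ) (k : Fin 4), ContDiff ℝ 1 κ →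
        (∀ w ∈ U, κ (P w) * wirtinger (x 0) w = wirtinger (x k) w) →
        ∃ c : ℂ, HasFDerivAt κ (c • isothermalForm φ ψ p) p := by
      intro κ k hκ hk
      obtain ⟨c, hc⟩ := hhol k
      have hκd := (hκ.contDiffAt (x := p)).differentiableAt one_ne_zero
      have h1 : HasFDerivAt (fun w => κ (P w)) ((fderiv ℝ κ p).comp (fderiv ℝ P w₀)) w₀ :=
        HasFDerivAt.comp (g := κ) w₀ (by rw [hPp]; exact hκd.hasFDerivAt) hPw₀
      have h2 := (h1.mul hc0).unique (hc.congr_of_eventuallyEq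
        (Filter.eventuallyEq_of_mem (hU.mem_nhds hw₀) hk))
      refine ⟨(c - κ p * c0) / (wirtinger (x 0) w₀ * m w₀), hκd.hasFDerivAt.congr_fderiv ?_⟩
      ext1 v
      obtain ⟨u, rfl⟩ := hsurj v
      have h3 := congrArg (fun L : E2 →L[ℝ] ℂ => L u) h2
      have h4 := hform w₀ hw₀ u
      rw [hPp] at h4
      simp [hPp] at h3
      simp only [smul_apply, smul_eq_mul, h4]
      field_simp
      linear_combination h3
    rintro κ (rfl | rfl | rfl)
    · exact main _ 1 (contDiff_graphSlope hφ hψ) hslope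
    · exact main _ 2 (contDiff_graphSlopeOf hφ hψ hφ) (hslopeOf φ 2 hx2)
    · exact main _ 3 (contDiff_graphSlopeOf hφ hψ hψ) (hslopeOf ψ 3 hx3)

theorem affine_of_pdR_eq {f : E2 → ℝ} (hf : ContDiff ℝ 2 f) (h : ∀ p q i, pdR f i p = pdR f i q) :
    ∀ p : E2, f p = pdR f 0 0 * p 0 + pdR f 1 0 * p 1 + f 0 := by
  have hd : ∀ p, HasFDerivAt f (fderiv ℝ f 0) p := fun p => by
    refine (hf.contDiffAt.differentiableAt two_ne_zero).hasFDerivAt.congr_fderiv ?_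
    ext1 v
    rw [clm_apply_eq, clm_apply_eq (fderiv ℝ f 0)]
    exact congrArg₂ (· + ·) (congrArg _ (h p 0 0)) (congrArg _ (h p 0 1))
  intro p
  have hz : ∀ q, HasFDerivAt (fun q => f q - fderiv ℝ f 0 q) (0 : E2 →L[ℝ] ℝ) q := fun q => by
    simpa using! (hd q).sub (fderiv ℝ f 0).hasFDerivAt
  have hc := is_const_of_fderiv_eq_zero (𝕜 := ℝ) (fun q => (hz q).differentiableAt)
    (fun q => (hz q).fderiv) p 0
  have e := clm_apply_eq (fderiv ℝ f 0) p
  simp only [map_zero, smul_eq_mul] at hc e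
  simp only [pdR]
  linear_combination hc + e

/-- **Bernstein-type theorem.** A complete minimal graph
`X(x,y) = (x, y, φ(x,y), ψ(x,y))` in `ℝ⁴` satisfying the Dirichlet growth condition
(A4) and the normal angle condition (A5) is an affine plane. -/
theorem bernstein_type_theorem_minimal_graph_R4
    (φ ψ : E2 → ℝ) (hφ : ContDiff ℝ 2 φ) (hψ : ContDiff ℝ 2 ψ)
    (ω : ℝ) (hω : ω ∈ Set.Ioc 0 (π / 2))
    (d₀ : ℝ) (hd₀ : 0 < d₀)
    -- (i) every normal of the graph makes an angle of at least ω with the x¹-axis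
    (hangle : ∀ p : E2, ∀ N : E4, ‖N‖ = 1 →
      ⟪N, pd (graphMap φ ψ) 0 p⟫ = 0 → ⟪N, pd (graphMap φ ψ) 1 p⟫ = 0 →
      |⟪N, EuclideanSpace.single (0 : Fin 4) 1⟫| ≤ Real.cos ω)
    -- (ii) around every point the graph contains conformally parametrized minimal
    -- geodesic discs of every radius r with Dirichlet energy at most d₀ r²
    (hdiscs : ∀ p : E2, ∀ r : ℝ, 0 < r →
      ∃ (Xr : E2 → E4) (Wr : E2 → ℝ),
        ContDiffOn ℝ 2 Xr (ball (0 : E2) 1) ∧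
        (∀ w ∈ ball (0 : E2) 1,
          ⟪pd Xr 0 w, pd Xr 0 w⟫ = Wr w ∧ ⟪pd Xr 1 w, pd Xr 1 w⟫ = Wr w ∧
          ⟪pd Xr 0 w, pd Xr 1 w⟫ = 0 ∧ 0 < Wr w) ∧
        (∀ w ∈ ball (0 : E2) 1, ∃ q : E2, Xr w = graphMap φ ψ q) ∧
        (∀ w ∈ ball (0 : E2) 1, pd2 Xr 0 0 w + pd2 Xr 1 1 w = 0) ∧
        Xr 0 = graphMap φ ψ p ∧
        (∀ γ : ℝ → E2, ContDiff ℝ 1 γ →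
          (∀ t ∈ Set.Icc (0 : ℝ) 1, γ t ∈ closedBall (0 : E2) 1) →
          γ 0 = 0 → ‖γ 1‖ = 1 →
          r ≤ ∫ t in (0 : ℝ)..1, ‖deriv (Xr ∘ γ) t‖) ∧
        (∫ w in ball (0 : E2) 1, (‖pd Xr 0 w‖ ^ 2 + ‖pd Xr 1 w‖ ^ 2)) ≤ d₀ * r ^ 2 ∧
        Set.InjOn (fun w => (Xr w 0, Xr w 1)) (ball (0 : E2) 1) ∧
        (∀ w ∈ ball (0 : E2) 1,
          0 < pdR (fun w' => Xr w' 0) 0 w * pdR (fun w' => Xr w' 1) 1 w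
              - pdR (fun w' => Xr w' 0) 1 w * pdR (fun w' => Xr w' 1) 0 w)) :
    ∃ a₁ b₁ c₁ a₂ b₂ c₂ : ℝ, ∀ p : E2,
      φ p = a₁ * p 0 + b₁ * p 1 + c₁ ∧ ψ p = a₂ * p 0 + b₂ * p 1 + c₂ := by
  choose X W hX hconf hgraph hharm hp _ _ _ hJ using fun p => hdiscs p 1 one_pos
  have hloc := fun p => closed_and_holomorphic_of_disc hφ hψ isOpen_ball (mem_ball_self one_pos)
    (hX p) (hconf p) (hgraph p) (hharm p) (hp p) (hJ p)
  obtain ⟨Z, hZ⟩ := convex_univ.exists_forall_hasFDerivAt_of_fderiv_symmetric isOpen_univ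
    ((contDiff_isothermalForm hφ hψ).differentiable one_ne_zero).differentiableOn
    fun p _ => (hloc p).1
  have hsin : 0 < Real.sin ω := Real.sin_pos_of_pos_of_lt_pi hω.1 (by linarith [hω.2, Real.pi_pos])
  have hbound : ∀ p, 2 * areaElement φ ψ p ^ 2 / metricG φ ψ p ≤ 2 / Real.sin ω ^ 2 := fun p => by
    have h := sin_sq_mul_areaElement_sq_le hφ hψ p (hangle p)
    rw [div_le_div_iff₀ (metricG_pos φ ψ p) (by positivity)]
    linarith
  have hconst : ∀ κ ∈ ({graphSlope φ ψ, graphSlopeOf φ ψ φ, graphSlopeOf φ ψ ψ} : Set (E2 → ℂ)),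
      ∀ p q, κ p = κ q := by
    intro κ hκ
    refine eq_of_fderiv_eq_smul_isothermalForm hφ hψ (fun p => hZ p (Set.mem_univ p))
      (fun p => (hloc p).2 κ hκ) (C := √(2 / Real.sin ω ^ 2)) fun p => ?_
    refine Real.le_sqrt_of_sq_le ((?_ : _ ≤ _).trans (hbound p))
    rw [← normSq_graphSlope_add, Complex.sq_norm]
    have h1 := Complex.normSq_nonneg (graphSlope φ ψ p)
    have h2 := Complex.normSq_nonneg (graphSlopeOf φ ψ φ p)
    have h3 := Complex.normSq_nonneg (graphSlopeOf φ ψ ψ p)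
    rcases hκ with rfl | rfl | rfl <;> linarith
  have hslope := hconst _ (by simp : graphSlope φ ψ ∈ _)
  have hgrad : ∀ f : E2 → ℝ, (∀ p q, graphSlopeOf φ ψ f p = graphSlopeOf φ ψ f q) →
      ∀ p q i, pdR f i p = pdR f i q := by
    intro f hf p q
    have him : (graphSlope φ ψ q).im ≠ 0 :=
      div_ne_zero (neg_ne_zero.2 (areaElement_pos φ ψ q).ne') (metricG_pos φ ψ q).ne'
    have h := hf p q
    rw [graphSlopeOf, graphSlopeOf, hslope p q] at h
    have hi := congrArg Complex.im h
    have hr := congrArg Complex.re h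
    simp only [Complex.add_re, Complex.add_im, Complex.ofReal_re, Complex.ofReal_im,
      Complex.re_ofReal_mul, Complex.im_ofReal_mul, zero_add] at hi hr
    have h1 : pdR f 1 p = pdR f 1 q := mul_right_cancel₀ him hi
    rw [h1] at hr
    intro i
    fin_cases i
    · exact add_right_cancel hr
    · exact h1
  exact ⟨_, _, _, _, _, _, fun p =>
    ⟨affine_of_pdR_eq hφ (hgrad φ (hconst _ (by simp))) p,
      affine_of_pdR_eq hψ (hgrad ψ (hconst _ (by simp))) p⟩⟩
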